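/- arXiv:1701.08321 — 2 statements merged into one kernel-verified Lean document; each statement's English description precedes it below -/
import Mathlib

section
/- Let A ⊆ Homeo₊(I) be a finite geometrically proper set of positive bump functions. The following are equivalent: (1) A is geometrically fast; (2) every stretched transition chain C of A satisfies C_max ≤ (C_min)(∏C), where (C_min)(∏C) denotes the image of C_min under the composition ∏C; (3) every maximal stretched transition chain C of A satisfies C_max ≤ (C_min)(∏C). -/
open Set

/-- The unit interval `[0,1]` as a type. -/
abbrev UI : Type := ↥unitInterval

/-- Bijections of the unit interval; orientation-preserving homeomorphisms are
exactly the monotone ones among these. -/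
abbrev Homeo01 : Type := Equiv.Perm UI

namespace PingPong

/-- The support of `f`. -/
def supt (f : Homeo01) : Set UI := {t | f t ≠ t}

/-- `f` is an orientation-preserving homeomorphism of `[0,1]`:
a monotone bijection of `[0,1]` (automatically a homeomorphism). -/
def IsOPH (f : Homeo01) : Prop := Monotone ⇑f

/-- A bump function: an orientation preserving homeomorphism with exactly one
orbital, i.e. whose support is nonempty and connected. -/
def IsBump (f : Homeo01) : Prop := IsOPH f ∧ IsConnected (supt f)

/-- A positive bump function. -/
def IsPosBump (f : Homeo01) : Prop := IsBump f ∧ ∀ t ∈ supt f, t < f t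

/-- The source of a positive bump `a` with marker `t`. -/
def src (a : Homeo01) (t : UI) : Set UI := {s ∈ supt a | s < t}

/-- The destination of a positive bump `a` with marker `t`. -/
def dest (a : Homeo01) (t : UI) : Set UI := {s ∈ supt a | a t ≤ s}

/-- `m` is a marking of the collection `A` of bumps. -/
def IsMarking (A : Set Homeo01) (m : Homeo01 → UI) : Prop := ∀ a ∈ A, m a ∈ supt a

/-- The feet of a marked bump: `false` gives the source, `true` the destination. -/
def foot (a : Homeo01) (t : UI) : Bool → Set UI
  | false => src a t
  | true => dest a t

/-- The feet of the marked family `(A, m)` are pairwise disjoint. -/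
def FeetDisjoint (A : Set Homeo01) (m : Homeo01 → UI) : Prop :=
  ∀ a ∈ A, ∀ b ∈ A, ∀ i j : Bool, (a, i) ≠ (b, j) →
    Disjoint (foot a (m a) i) (foot b (m b) j)

/-- A geometrically fast collection of (positive) bumps. -/
def FastBumps (A : Set Homeo01) : Prop :=
  (∀ a ∈ A, IsPosBump a) ∧ ∃ m : Homeo01 → UI, IsMarking A m ∧ FeetDisjoint A m

/-- `t` is a left transition point of `f`. -/
def IsLeftTransition (f : Homeo01) (t : UI) : Prop :=
  t ∉ supt f ∧ ∀ ε : ℝ, 0 < ε → ∃ s ∈ supt f, t < s ∧ (s : ℝ) < (t : ℝ) + ε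

/-- `t` is a right transition point of `f`. -/
def IsRightTransition (f : Homeo01) (t : UI) : Prop :=
  t ∉ supt f ∧ ∀ ε : ℝ, 0 < ε → ∃ s ∈ supt f, s < t ∧ (t : ℝ) - ε < (s : ℝ)

/-- `t` is a transition point of `f`. -/
def IsTransition (f : Homeo01) (t : UI) : Prop :=
  IsLeftTransition f t ∨ IsRightTransition f t

/-- A geometrically proper set of homeomorphisms. -/
def GeomProper (X : Set Homeo01) : Prop :=
  (∀ f ∈ X, ∀ g ∈ X, f ≠ g → ∀ t : UI, ¬(IsLeftTransition f t ∧ IsLeftTransition g t)) ∧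
  (∀ f ∈ X, ∀ g ∈ X, f ≠ g → ∀ t : UI, ¬(IsRightTransition f t ∧ IsRightTransition g t))

/-- The positive bump `a` is used in `f`. -/
def UsedIn (f a : Homeo01) : Prop :=
  IsPosBump a ∧ (Set.EqOn ⇑f ⇑a (supt a) ∨ Set.EqOn ⇑f ⇑a⁻¹ (supt a))

/-- The set of (positive) bumps used in `X`. -/
def usedBumps (X : Set Homeo01) : Set Homeo01 := {a | ∃ f ∈ X, UsedIn f a}

/-- A geometrically fast set of homeomorphisms. -/
def GeomFast (X : Set Homeo01) : Prop := GeomProper X ∧ FastBumps (usedBumps X)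

/-- The set of transition points of elements of `X`. -/
def transitionPoints (X : Set Homeo01) : Set UI := {t | ∃ f ∈ X, IsTransition f t}

/-! ### Words -/

/-- A word in the alphabet `A^± = A ∪ A⁻¹`, recorded as a list of the permutations
represented by its symbols (for a set `A` of positive bumps this is faithful,
since `A ∩ A⁻¹ = ∅`). -/
def WordOn (A : Set Homeo01) (w : List Homeo01) : Prop := ∀ x ∈ w, x ∈ A ∨ x⁻¹ ∈ A

/-- A freely reduced word: no symbol is immediately followed by its inverse. -/
def FreelyReduced (w : List Homeo01) : Prop := List.Chain' (fun a b => b ≠ a⁻¹) w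

/-- The right action of a word on a point: apply the symbols from left to right. -/
def act (t : UI) (w : List Homeo01) : UI := w.foldl (fun s a => a s) t

/-- `w` is locally reduced at `t`. -/
def LocallyReducedAt (w : List Homeo01) (t : UI) : Prop :=
  FreelyReduced w ∧ ∀ (u : List Homeo01) (a : Homeo01), u ++ [a] <+: w → a (act t u) ≠ act t u

open Classical in
/-- The source of a symbol of `A^±`: for `a ∈ A` it is `src a`, and for the
formal inverse of an element of `A` it is the destination of that element. -/
noncomputable def symSrc (A : Set Homeo01) (m : Homeo01 → UI) (b : Homeo01) : Set UI :=
  if b ∈ A then src b (m b) else dest b⁻¹ (m b⁻¹)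

open Classical in
/-- The destination of a symbol of `A^±`. -/
noncomputable def symDest (A : Set Homeo01) (m : Homeo01 → UI) (b : Homeo01) : Set UI :=
  if b ∈ A then dest b (m b) else src b⁻¹ (m b⁻¹)

/-- The source of a word: the source of its first symbol (empty for the empty word). -/
noncomputable def wordSrc (A : Set Homeo01) (m : Homeo01 → UI) : List Homeo01 → Set UI
  | [] => ∅
  | a :: _ => symSrc A m a

/-- The destination of a word: the destination of its last symbol. -/
noncomputable def wordDest (A : Set Homeo01) (m : Homeo01 → UI) (w : List Homeo01) : Set UI :=
  match w.getLast? with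
  | none => ∅
  | some a => symDest A m a

/-- `J(w) = supt(a) \ src(a)` where `a` is the first symbol of `w`. -/
noncomputable def Jset (A : Set Homeo01) (m : Homeo01 → UI) : List Homeo01 → Set UI
  | [] => ∅
  | a :: _ => supt a \ symSrc A m a

/-- `t` has trivial history: it lies in no foot of any element of `A`. -/
def TrivialHistory (A : Set Homeo01) (m : Homeo01 → UI) (t : UI) : Prop :=
  ∀ a ∈ A, t ∉ src a (m a) ∧ t ∉ dest a (m a)

/-- `x` has finite history: there is a finite bound on the lengths of `A`-words
locally reduced at `x` whose evaluation at `x` is outside their destination. -/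
def FiniteHistory (A : Set Homeo01) (m : Homeo01 → UI) (x : UI) : Prop :=
  ∃ n : ℕ, ∀ w : List Homeo01, WordOn A w → LocallyReducedAt w x →
    act x w ∉ wordDest A m w → w.length ≤ n

/-- A return word for `x`. -/
def IsReturnWord (x : UI) (w : List Homeo01) : Prop := w ≠ [] ∧ act x w = x

/-- `w` has a return prefix for `x`. -/
def HasReturnPrefix (x : UI) (w : List Homeo01) : Prop :=
  ∃ v : List Homeo01, v <+: w ∧ IsReturnWord x v

/-- The set of initial markers of the marked family `(A, m)`. -/
def initialMarkers (A : Set Homeo01) (m : Homeo01 → UI) : Set UI :=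
  {t | (∃ a ∈ A, m a = t) ∧ ∀ b ∈ A, m b < t → b (m b) ≠ t}

/-- `M⟨X⟩`: the orbit of the set of initial markers of `(A, m)` under the group
generated by `X`. -/
def MOrbit (A : Set Homeo01) (m : Homeo01 → UI) (X : Set Homeo01) : Set UI :=
  {u | ∃ t ∈ initialMarkers A m, ∃ g ∈ Subgroup.closure X, g t = u}

end PingPong
namespace PingPong

/-! ### Piecewise linear maps and Thompson's group F -/

/-- `f` is piecewise linear (finitely many affine pieces). -/
def IsPL (f : Homeo01) : Prop :=
  ∃ (n : ℕ) (t : Fin (n + 1) → ℝ), StrictMono t ∧ t 0 = 0 ∧ t (Fin.last n) = 1 ∧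
    ∀ i : Fin n, ∃ c d : ℝ, ∀ s : UI,
      t i.castSucc ≤ (s : ℝ) → (s : ℝ) ≤ t i.succ → ((f s : ℝ)) = c * (s : ℝ) + d

/-- `x` is a dyadic rational. -/
def IsDyadic (x : ℝ) : Prop := ∃ (a : ℤ) (k : ℕ), x = (a : ℝ) / 2 ^ k

/-- `f` belongs to Thompson's group `F`: an orientation-preserving piecewise linear
homeomorphism of `[0,1]` with dyadic breakpoints and slopes integer powers of `2`. -/
def InThompsonF (f : Homeo01) : Prop :=
  IsOPH f ∧
  ∃ (n : ℕ) (t : Fin (n + 1) → ℝ), StrictMono t ∧ t 0 = 0 ∧ t (Fin.last n) = 1 ∧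
    (∀ i, IsDyadic (t i)) ∧
    ∀ i : Fin n, ∃ (k : ℤ) (d : ℝ), ∀ s : UI,
      t i.castSucc ≤ (s : ℝ) → (s : ℝ) ≤ t i.succ → ((f s : ℝ)) = (2 : ℝ) ^ k * (s : ℝ) + d

/-! ### Stretched transition chains -/

/-- `a` is isolated in `A`: its support contains no transition point of an element of `A`. -/
def IsolatedIn (A : Set Homeo01) (a : Homeo01) : Prop :=
  ∀ t ∈ supt a, ∀ b ∈ A, ¬ IsTransition b t

/-- `c` (with supports `(x i, y i)`) is a stretched transition chain of `A`. -/
def IsSTC (A : Set Homeo01) (k : ℕ) (c : Fin (k + 1) → Homeo01)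
    (x y : Fin (k + 1) → ℝ) : Prop :=
  (∀ i, c i ∈ A ∧ ¬ IsolatedIn A (c i)) ∧
  (∀ i, supt (c i) = {t : UI | x i < (t : ℝ) ∧ (t : ℝ) < y i}) ∧
  (∀ i : Fin k, x i.castSucc < x i.succ ∧ x i.succ < y i.castSucc ∧ y i.castSucc < y i.succ) ∧
  (∀ i : Fin k, ∀ t : UI, x i.succ < (t : ℝ) → (t : ℝ) < y i.castSucc →
    ∀ b ∈ A, ¬ IsTransition b t)

/-- `S` is the underlying set of some stretched transition chain of `A`. -/
def ChainSet (A : Set Homeo01) (S : Set Homeo01) : Prop :=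
  ∃ (k : ℕ) (c : Fin (k + 1) → Homeo01) (x y : Fin (k + 1) → ℝ),
    IsSTC A k c x y ∧ S = Set.range c

/-- `S` is the underlying set of a maximal stretched transition chain of `A`. -/
def MaxChainSet (A : Set Homeo01) (S : Set Homeo01) : Prop :=
  ChainSet A S ∧ ∀ S' : Set Homeo01, ChainSet A S' → S ⊆ S' → S = S'

/-- The transition points of `A` lying in the support of the chain `c`. -/
def chainTrans (A : Set Homeo01) (k : ℕ) (c : Fin (k + 1) → Homeo01) : Set UI :=
  {t | (∃ i, t ∈ supt (c i)) ∧ ∃ b ∈ A, IsTransition b t}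

/-- The image of `t` under the composition `∏ C = c 0 ⋯ c k`. -/
def chainApply (k : ℕ) (c : Fin (k + 1) → Homeo01) (t : UI) : UI :=
  (List.ofFn c).foldl (fun s a => a s) t

/-! ### Dynamical diagrams -/

/-- The collection of feet of the bumps used in `X`, with marking `m`. -/
def Feet (X : Set Homeo01) (m : Homeo01 → UI) : Set (Set UI) :=
  {S | ∃ a ∈ usedBumps X, S = src a (m a) ∨ S = dest a (m a)}

/-- The signed bumps of `f`: bumps agreeing with `f` on their support. -/
def signedBumps (f : Homeo01) : Set Homeo01 :=
  {b | IsBump b ∧ Set.EqOn ⇑b ⇑f (supt b)}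

open Classical in
/-- The source of a signed bump, with respect to the marking `m` of the positive bumps. -/
noncomputable def sSrc (m : Homeo01 → UI) (b : Homeo01) : Set UI :=
  if IsPosBump b then src b (m b) else dest b⁻¹ (m b⁻¹)

open Classical in
/-- The destination of a signed bump, with respect to the marking `m` of the positive bumps. -/
noncomputable def sDest (m : Homeo01 → UI) (b : Homeo01) : Set UI :=
  if IsPosBump b then dest b (m b) else src b⁻¹ (m b⁻¹)

/-- An isomorphism of the dynamical diagrams of the marked families `(X, mX)` and
`(Y, mY)`, inducing the bijection `τ : X → Y`: an order-preserving bijection `Φ`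
between the collections of feet, together with, for each `f ∈ X`, a bijection of the
signed bumps of `f` with those of `τ f` under which `Φ` matches sources with sources
and destinations with destinations. -/
def DiagIso (X : Set Homeo01) (mX : Homeo01 → UI) (Y : Set Homeo01) (mY : Homeo01 → UI)
    (τ : Homeo01 → Homeo01) : Prop :=
  Set.BijOn τ X Y ∧
  ∃ Φ : Set UI → Set UI,
    Set.BijOn Φ (Feet X mX) (Feet Y mY) ∧
    (∀ S ∈ Feet X mX, ∀ T ∈ Feet X mX,
      (∀ s ∈ S, ∀ t ∈ T, s < t) → ∀ s ∈ Φ S, ∀ t ∈ Φ T, s < t) ∧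
    ∀ f ∈ X, ∃ β : Homeo01 → Homeo01,
      Set.BijOn β (signedBumps f) (signedBumps (τ f)) ∧
      ∀ b ∈ signedBumps f, Φ (sSrc mX b) = sSrc mY (β b) ∧ Φ (sDest mX b) = sDest mY (β b)

/-! ### Excision -/

/-- The union of the supports of the bumps of `E` used in `f`. -/
def quotSupp (f : Homeo01) (E : Set Homeo01) : Set UI :=
  {t | ∃ a ∈ E, UsedIn f a ∧ t ∈ supt a}

/-- `g = f/E`: `g` is the identity on the supports of the bumps of `E` used in `f`,
and agrees with `f` elsewhere. -/
def IsQuot (f : Homeo01) (E : Set Homeo01) (g : Homeo01) : Prop :=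
  (∀ t ∈ quotSupp f E, g t = t) ∧ ∀ t ∉ quotSupp f E, g t = f t

/-- `E` is extraneous in `X` (with respect to the marking `m`), witnessed by an
interval `J`. -/
def Extraneous (X : Set Homeo01) (m : Homeo01 → UI) (E : Set Homeo01) : Prop :=
  ∃ J : Set UI, J.OrdConnected ∧ ∃ f ∈ X,
    (∀ e ∈ E, UsedIn f e ∧ IsolatedIn (usedBumps X) e ∧ supt e ⊆ J) ∧
    (∃ a : Homeo01, UsedIn f a ∧ a ∉ E ∧ (src a (m a) ⊆ J ∨ dest a (m a) ⊆ J)) ∧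
    ∀ g ∈ X, g ≠ f → ∀ b : Homeo01, UsedIn g b →
      Disjoint (src b (m b)) J ∧ Disjoint (dest b (m b)) J

end PingPong
namespace PingPong

/-- The left endpoint of the support of a bump. -/
noncomputable def leftEnd (f : Homeo01) : UI := sInf (supt f)

/-- The right endpoint of the support of a bump. -/
noncomputable def rightEnd (f : Homeo01) : UI := sSup (supt f)

lemma IsBump.supt_eq {f : Homeo01} (hf : IsBump f) :
    supt f = Ioo (leftEnd f) (rightEnd f) := by
  obtain ⟨hmono, hconn⟩ := hf
  have hcont : Continuous ⇑f := Monotone.continuous_of_surjective hmono f.surjective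
  have hopen : IsOpen (supt f) := isOpen_ne_fun hcont continuous_id
  have h0 : (⊥ : UI) ∉ supt f := fun h => h <| by
    obtain ⟨s, hs⟩ := f.surjective ⊥
    exact le_bot_iff.1 ((hmono (bot_le (a := s))).trans_eq hs)
  have h1 : (⊤ : UI) ∉ supt f := fun h => h <| by
    obtain ⟨s, hs⟩ := f.surjective ⊤
    exact top_le_iff.1 (hs.symm.trans_le (hmono (le_top (a := s))))
  have hord := hconn.isPreconnected.ordConnected
  have hinf : sInf (supt f) ∉ supt f := by
    intro h
    obtain ⟨l, hl, hsub⟩ := exists_Ioc_subset_of_mem_nhds (hopen.mem_nhds h)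
      ⟨⊥, bot_lt_iff_ne_bot.2 fun e => h0 (e ▸ h)⟩
    obtain ⟨z, hz⟩ := exists_between hl
    exact (sInf_le (hsub ⟨hz.1, hz.2.le⟩)).not_gt hz.2
  have hsup : sSup (supt f) ∉ supt f := by
    intro h
    obtain ⟨l, hl, hsub⟩ := exists_Ico_subset_of_mem_nhds (hopen.mem_nhds h)
      ⟨⊤, lt_top_iff_ne_top.2 fun e => h1 (e ▸ h)⟩
    obtain ⟨z, hz⟩ := exists_between hl
    exact (le_sSup (hsub ⟨hz.1.le, hz.2⟩)).not_gt hz.1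
  ext t
  constructor
  · exact fun ht => ⟨(sInf_le ht).lt_of_ne fun e => hinf (e ▸ ht),
      (le_sSup ht).lt_of_ne fun e => hsup (e ▸ ht)⟩
  · rintro ⟨hl, hr⟩
    obtain ⟨a, ha, hat⟩ := sInf_lt_iff.1 hl
    obtain ⟨b, hb, htb⟩ := lt_sSup_iff.1 hr
    exact hord.out ha hb ⟨hat.le, htb.le⟩

lemma IsBump.leftEnd_lt_rightEnd {f : Homeo01} (hf : IsBump f) : leftEnd f < rightEnd f := by
  obtain ⟨t, ht⟩ := hf.2.nonempty
  rw [hf.supt_eq] at ht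
  exact ht.1.trans ht.2

lemma isLeftTransition_iff {f : Homeo01} {x y : UI} (hxy : x < y) (hf : supt f = Ioo x y)
    (t : UI) : IsLeftTransition f t ↔ t = x := by
  unfold IsLeftTransition
  rw [hf]
  constructor
  · rintro ⟨hnot, h⟩
    by_contra hne
    rcases lt_or_gt_of_ne hne with hlt | hgt
    · obtain ⟨s, hs, -, hs2⟩ := h ((x : ℝ) - t) (sub_pos.2 hlt)
      have : (x : ℝ) < s := hs.1
      linarith
    · obtain ⟨s, hs, hts, -⟩ := h 1 one_pos
      exact hnot ⟨hgt, hts.trans hs.2⟩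
  · rintro rfl
    refine ⟨fun h => lt_irrefl _ h.1, fun ε hε => ?_⟩
    have hxy' : (t : ℝ) < y := hxy
    obtain ⟨s, hs1, hs2⟩ := exists_between (lt_min hxy' (lt_add_of_pos_right (t : ℝ) hε))
    refine ⟨⟨s, t.2.1.trans hs1.le, (hs2.le.trans (min_le_left _ _)).trans y.2.2⟩, ⟨?_, ?_⟩, ?_, ?_⟩
    · exact hs1
    · exact hs2.trans_le (min_le_left _ _)
    · exact hs1
    · exact hs2.trans_le (min_le_right _ _)

lemma isRightTransition_iff {f : Homeo01} {x y : UI} (hxy : x < y) (hf : supt f = Ioo x y)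
    (t : UI) : IsRightTransition f t ↔ t = y := by
  unfold IsRightTransition
  rw [hf]
  constructor
  · rintro ⟨hnot, h⟩
    by_contra hne
    rcases lt_or_gt_of_ne hne with hlt | hgt
    · obtain ⟨s, hs, hts, -⟩ := h 1 one_pos
      exact hnot ⟨hs.1.trans hts, hlt⟩
    · obtain ⟨s, hs, -, hs2⟩ := h ((t : ℝ) - y) (sub_pos.2 hgt)
      have : (s : ℝ) < y := hs.2
      linarith
  · rintro rfl
    refine ⟨fun h => lt_irrefl _ h.2, fun ε hε => ?_⟩
    have hxy' : (x : ℝ) < t := hxy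
    obtain ⟨s, hs1, hs2⟩ := exists_between (max_lt hxy' (sub_lt_self (t : ℝ) hε))
    refine ⟨⟨s, (x.2.1.trans (le_max_left _ _)).trans hs1.le, hs2.le.trans t.2.2⟩, ⟨?_, ?_⟩, ?_, ?_⟩
    · exact (le_max_left (x : ℝ) _).trans_lt hs1
    · exact hs2
    · exact hs2
    · exact (le_max_right (x : ℝ) _).trans_lt hs1

lemma coe_endpoints_eq {x y : UI} (hxy : x < y) {u v : ℝ} {f : Homeo01}
    (hs : supt f = Ioo x y) (h : supt f = {t : UI | u < (t : ℝ) ∧ (t : ℝ) < v}) :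
    u = x ∧ v = y := by
  have key : ∀ t : UI, (x < t ∧ t < y) ↔ (u < (t : ℝ) ∧ (t : ℝ) < v) := fun t => by
    rw [hs] at h
    exact Set.ext_iff.1 h t
  obtain ⟨z, hz1, hz2⟩ := exists_between hxy
  have hz := (key z).1 ⟨hz1, hz2⟩
  have hz1' : (x : ℝ) < z := hz1
  have hz2' : (z : ℝ) < y := hz2
  have hxn : ¬ (u < (x : ℝ)) := fun hu => lt_irrefl _ ((key x).2 ⟨hu, hz1'.trans hz.2⟩).1
  have hyn : ¬ ((y : ℝ) < v) := fun hv => lt_irrefl _ ((key y).2 ⟨hz.1.trans hz2', hv⟩).2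
  constructor
  · refine le_antisymm ?_ (not_lt.1 hxn)
    by_contra! hlt
    have := (key ⟨u, x.2.1.trans hlt.le, hz.1.le.trans z.2.2⟩).1
      ⟨hlt, show u < (y : ℝ) from hz.1.trans hz2'⟩
    exact lt_irrefl _ this.1
  · refine le_antisymm (not_lt.1 hyn) ?_
    by_contra! hlt
    have := (key ⟨v, z.2.1.trans hz.2.le, hlt.le.trans y.2.2⟩).1
      ⟨show (x : ℝ) < v from hz1'.trans hz.2, hlt⟩
    exact lt_irrefl _ this.2

lemma chainApply_zero (c : Fin 1 → Homeo01) (t : UI) : chainApply 0 c t = c 0 t := by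
  simp [chainApply]

lemma chainApply_succ (k : ℕ) (c : Fin (k + 1 + 1) → Homeo01) (t : UI) :
    chainApply (k + 1) c t =
      c (Fin.last (k + 1)) (chainApply k (fun i => c i.castSucc) t) := by
  unfold chainApply
  rw [List.ofFn_succ', List.concat_eq_append, List.foldl_append]
  rfl

lemma le_chainApply {k : ℕ} {c : Fin (k + 1) → Homeo01} (hc : ∀ i, IsOPH (c i))
    {s : Fin (k + 1) → UI} (hs : ∀ i : Fin k, s i.succ ≤ c i.castSucc (s i.castSucc))
    {t : UI} (ht : s 0 ≤ t) : c (Fin.last k) (s (Fin.last k)) ≤ chainApply k c t := by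
  induction k with
  | zero => rw [chainApply_zero]; exact hc 0 ht
  | succ k ih =>
    rw [chainApply_succ]
    exact hc _ ((hs (Fin.last k)).trans
      (ih (fun i => hc i.castSucc) (s := fun i => s i.castSucc) (fun i => hs i.castSucc) ht))

lemma chainApply_le {k : ℕ} {c : Fin (k + 1) → Homeo01} (hc : ∀ i, IsOPH (c i))
    {s : Fin (k + 1) → UI} (hs : ∀ i : Fin k, c i.castSucc (s i.castSucc) ≤ s i.succ)
    {t : UI} (ht : t ≤ s 0) : chainApply k c t ≤ c (Fin.last k) (s (Fin.last k)) := by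
  induction k with
  | zero => rw [chainApply_zero]; exact hc 0 ht
  | succ k ih =>
    rw [chainApply_succ]
    exact hc _ ((ih (fun i => hc i.castSucc) (s := fun i => s i.castSucc)
      (fun i => hs i.castSucc) ht).trans (hs (Fin.last k)))

lemma IsBump.mem_supt {f : Homeo01} (hf : IsBump f) {t : UI} :
    t ∈ supt f ↔ leftEnd f < t ∧ t < rightEnd f := by
  rw [hf.supt_eq, mem_Ioo]

lemma IsBump.apply_leftEnd {f : Homeo01} (hf : IsBump f) : f (leftEnd f) = leftEnd f :=
  not_not.1 fun h => lt_irrefl _ (hf.mem_supt.1 h).1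

lemma IsBump.apply_rightEnd {f : Homeo01} (hf : IsBump f) : f (rightEnd f) = rightEnd f :=
  not_not.1 fun h => lt_irrefl _ (hf.mem_supt.1 h).2

lemma IsBump.apply_le_leftEnd {f : Homeo01} (hf : IsBump f) {t : UI} (ht : t ≤ leftEnd f) :
    f t ≤ leftEnd f :=
  (hf.1 ht).trans_eq hf.apply_leftEnd

lemma IsBump.apply_lt_rightEnd {f : Homeo01} (hf : IsBump f) {t : UI} (ht : t < rightEnd f) :
    f t < rightEnd f :=
  ((Monotone.strictMono_of_injective hf.1 f.injective) ht).trans_eq hf.apply_rightEnd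

lemma IsPosBump.lt_apply {f : Homeo01} (hf : IsPosBump f) {t : UI} (hl : leftEnd f < t)
    (hr : t < rightEnd f) : t < f t :=
  hf.2 t (hf.1.mem_supt.2 ⟨hl, hr⟩)

section

variable {A : Set Homeo01}

lemma mem_transitionPoints_iff (hA : ∀ a ∈ A, IsPosBump a) {t : UI} :
    t ∈ transitionPoints A ↔ ∃ a ∈ A, t = leftEnd a ∨ t = rightEnd a := by
  refine exists_congr fun a => and_congr_right fun ha => ?_
  have hb := (hA a ha).1
  exact or_congr (isLeftTransition_iff hb.leftEnd_lt_rightEnd hb.supt_eq t)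
    (isRightTransition_iff hb.leftEnd_lt_rightEnd hb.supt_eq t)

lemma leftEnd_mem_transitionPoints (hA : ∀ a ∈ A, IsPosBump a) {a : Homeo01} (ha : a ∈ A) :
    leftEnd a ∈ transitionPoints A :=
  (mem_transitionPoints_iff hA).2 ⟨a, ha, Or.inl rfl⟩

lemma rightEnd_mem_transitionPoints (hA : ∀ a ∈ A, IsPosBump a) {a : Homeo01} (ha : a ∈ A) :
    rightEnd a ∈ transitionPoints A :=
  (mem_transitionPoints_iff hA).2 ⟨a, ha, Or.inr rfl⟩

lemma transitionPoints_finite (hA : ∀ a ∈ A, IsPosBump a) (hfin : A.Finite) :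
    (transitionPoints A).Finite := by
  refine ((hfin.image leftEnd).union (hfin.image rightEnd)).subset fun t ht => ?_
  obtain ⟨a, ha, rfl | rfl⟩ := (mem_transitionPoints_iff hA).1 ht
  · exact Or.inl ⟨a, ha, rfl⟩
  · exact Or.inr ⟨a, ha, rfl⟩

lemma GeomProper.injOn_leftEnd (hprop : GeomProper A) (hA : ∀ a ∈ A, IsPosBump a) :
    InjOn leftEnd A := by
  intro a ha b hb h
  by_contra hne
  have ha' := (hA a ha).1
  have hb' := (hA b hb).1
  exact hprop.1 a ha b hb hne (leftEnd a)
    ⟨(isLeftTransition_iff ha'.leftEnd_lt_rightEnd ha'.supt_eq _).2 rfl,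
      (isLeftTransition_iff hb'.leftEnd_lt_rightEnd hb'.supt_eq _).2 h⟩

lemma GeomProper.injOn_rightEnd (hprop : GeomProper A) (hA : ∀ a ∈ A, IsPosBump a) :
    InjOn rightEnd A := by
  intro a ha b hb h
  by_contra hne
  have ha' := (hA a ha).1
  have hb' := (hA b hb).1
  exact hprop.2 a ha b hb hne (rightEnd a)
    ⟨(isRightTransition_iff ha'.leftEnd_lt_rightEnd ha'.supt_eq _).2 rfl,
      (isRightTransition_iff hb'.leftEnd_lt_rightEnd hb'.supt_eq _).2 h⟩

/-- `a` can be immediately followed by `b` in a stretched transition chain of `A`. -/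
structure Linked (A : Set Homeo01) (a b : Homeo01) : Prop where
  mem_left : a ∈ A
  mem_right : b ∈ A
  leftEnd_lt : leftEnd a < leftEnd b
  overlap : leftEnd b < rightEnd a
  rightEnd_lt : rightEnd a < rightEnd b
  rightEnd_le : ∀ t ∈ transitionPoints A, leftEnd b < t → rightEnd a ≤ t

lemma Linked.left_unique (hprop : GeomProper A) (hA : ∀ a ∈ A, IsPosBump a)
    {a a' b : Homeo01} (h : Linked A a b) (h' : Linked A a' b) : a = a' :=
  hprop.injOn_rightEnd hA h.mem_left h'.mem_left <| le_antisymm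
    (h.rightEnd_le _ (rightEnd_mem_transitionPoints hA h'.mem_left) h'.overlap)
    (h'.rightEnd_le _ (rightEnd_mem_transitionPoints hA h.mem_left) h.overlap)

lemma Linked.not_isolatedIn_left (hA : ∀ a ∈ A, IsPosBump a) {a b : Homeo01}
    (h : Linked A a b) : ¬ IsolatedIn A a := fun hiso => by
  obtain ⟨f, hf, hft⟩ := leftEnd_mem_transitionPoints hA h.mem_right
  exact hiso _ ((hA a h.mem_left).1.mem_supt.2 ⟨h.leftEnd_lt, h.overlap⟩) f hf hft

lemma Linked.wellFounded (hfin : A.Finite) : WellFounded (Linked A) := by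
  refine Subrelation.wf (r := InvImage (· < ·) fun a => {b ∈ A | leftEnd b < leftEnd a}.ncard)
    ?_ (InvImage.wf _ Nat.lt_wfRel.wf)
  intro a b h
  refine Set.ncard_lt_ncard ⟨fun f hf => ⟨hf.1, hf.2.trans h.leftEnd_lt⟩, fun hsub => ?_⟩
    (hfin.subset (sep_subset _ _))
  exact lt_irrefl _ (hsub ⟨h.mem_left, h.leftEnd_lt⟩).2

lemma isSTC_iff (hA : ∀ a ∈ A, IsPosBump a) {k : ℕ} {c : Fin (k + 1) → Homeo01} :
    (∃ x y, IsSTC A k c x y) ↔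
      (∀ i, c i ∈ A ∧ ¬ IsolatedIn A (c i)) ∧
        ∀ i : Fin k, Linked A (c i.castSucc) (c i.succ) := by
  constructor
  · rintro ⟨x, y, hmem, hs, hlt, hT⟩
    refine ⟨hmem, fun i => ?_⟩
    have hxy : ∀ i, x i = leftEnd (c i) ∧ y i = rightEnd (c i) := fun i =>
      coe_endpoints_eq (hA _ (hmem i).1).1.leftEnd_lt_rightEnd (hA _ (hmem i).1).1.supt_eq (hs i)
    have h := hlt i
    have hTi := hT i
    rw [(hxy _).1, (hxy _).2, (hxy _).1, (hxy _).2] at h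
    rw [(hxy _).1, (hxy _).2] at hTi
    refine ⟨(hmem _).1, (hmem _).1, h.1, h.2.1, h.2.2, ?_⟩
    rintro t ⟨f, hf, hft⟩ ht
    by_contra! hlt
    exact hTi t ht hlt f hf hft
  · rintro ⟨hmem, hlink⟩
    refine ⟨fun i => leftEnd (c i), fun i => rightEnd (c i), hmem, fun i => ?_, fun i => ?_, ?_⟩
    · exact (hA _ (hmem i).1).1.supt_eq
    · exact ⟨(hlink i).leftEnd_lt, (hlink i).overlap, (hlink i).rightEnd_lt⟩
    · intro i t h1 h2 b hb hbt
      exact ((hlink i).rightEnd_le t ⟨b, hb, hbt⟩ h1).not_gt h2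

lemma chainSet_iff (hA : ∀ a ∈ A, IsPosBump a) {S : Set Homeo01} :
    ChainSet A S ↔ ∃ (k : ℕ) (c : Fin (k + 1) → Homeo01),
      ((∀ i, c i ∈ A ∧ ¬ IsolatedIn A (c i)) ∧
        ∀ i : Fin k, Linked A (c i.castSucc) (c i.succ)) ∧ S = range c := by
  simp only [← isSTC_iff hA]
  constructor
  · rintro ⟨k, c, x, y, h, rfl⟩
    exact ⟨k, c, ⟨x, y, h⟩, rfl⟩
  · rintro ⟨k, c, ⟨x, y, h⟩, rfl⟩
    exact ⟨k, c, x, y, h, rfl⟩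

/-- Every nonisolated element of `A` lies in a maximal stretched transition chain. -/
lemma exists_maxChainSet (hA : ∀ a ∈ A, IsPosBump a) (hfin : A.Finite) {a : Homeo01}
    (ha : a ∈ A) (hiso : ¬ IsolatedIn A a) : ∃ S, MaxChainSet A S ∧ a ∈ S := by
  have hfin' : {S | ChainSet A S}.Finite := by
    refine hfin.finite_subsets.subset ?_
    rintro S ⟨k, c, x, y, h, rfl⟩
    rintro _ ⟨i, rfl⟩
    exact (h.1 i).1
  have h0 : ChainSet A {a} := (chainSet_iff hA).2
    ⟨0, fun _ => a, ⟨fun _ => ⟨ha, hiso⟩, fun i => i.elim0⟩, range_const.symm⟩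
  obtain ⟨S, hS, hmax⟩ := hfin'.exists_le_maximal h0
  exact ⟨S, ⟨hmax.prop, fun S' hS' hsub => hmax.eq_of_le hS' hsub⟩, hS rfl⟩

lemma strictMono_leftEnd_of_linked {k : ℕ} {c : Fin (k + 1) → Homeo01}
    (hlink : ∀ i : Fin k, Linked A (c i.castSucc) (c i.succ)) :
    StrictMono fun i => leftEnd (c i) :=
  Fin.strictMono_iff_lt_succ.2 fun i => (hlink i).leftEnd_lt

lemma strictMono_rightEnd_of_linked {k : ℕ} {c : Fin (k + 1) → Homeo01}
    (hlink : ∀ i : Fin k, Linked A (c i.castSucc) (c i.succ)) :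
    StrictMono fun i => rightEnd (c i) :=
  Fin.strictMono_iff_lt_succ.2 fun i => (hlink i).rightEnd_lt

lemma MaxChainSet.not_linked_head (hA : ∀ a ∈ A, IsPosBump a) {k : ℕ}
    {c : Fin (k + 1) → Homeo01} (hmem : ∀ i, c i ∈ A ∧ ¬ IsolatedIn A (c i))
    (hlink : ∀ i : Fin k, Linked A (c i.castSucc) (c i.succ)) (hmax : MaxChainSet A (range c))
    (b : Homeo01) : ¬ Linked A b (c 0) := by
  intro hb
  have hcons : ChainSet A (insert b (range c)) := by
    refine (chainSet_iff hA).2 ⟨k + 1, Fin.cons b c, ⟨fun i => ?_, fun i => ?_⟩,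
      (Fin.range_cons b c).symm⟩
    · refine Fin.cases ⟨hb.mem_left, hb.not_isolatedIn_left hA⟩ (fun i => hmem i) i
    · refine Fin.cases hb (fun i => ?_) i
      exact hlink i
  have : b ∈ range c := by
    rw [hmax.2 _ hcons (subset_insert _ _)]
    exact mem_insert _ _
  obtain ⟨i, rfl⟩ := this
  exact hb.leftEnd_lt.not_ge ((strictMono_leftEnd_of_linked hlink).monotone (Fin.zero_le i))

/-- The conditions on a marking, in terms of transition points and links, which express that
its feet are pairwise disjoint. -/
structure IsAdapted (A : Set Homeo01) (m : Homeo01 → UI) : Prop where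
  leftEnd_lt : ∀ a ∈ A, leftEnd a < m a
  lt_rightEnd : ∀ a ∈ A, m a < rightEnd a
  le_of_leftEnd_lt : ∀ a ∈ A, ∀ t ∈ transitionPoints A, leftEnd a < t → m a ≤ t
  le_apply_of_lt_rightEnd : ∀ a ∈ A, ∀ t ∈ transitionPoints A, t < rightEnd a → t ≤ a (m a)
  le_apply_of_linked : ∀ a b, Linked A a b → m b ≤ a (m a)

lemma IsAdapted.fastBumps (hprop : GeomProper A) (hA : ∀ a ∈ A, IsPosBump a)
    {m : Homeo01 → UI} (h : IsAdapted A m) : FastBumps A := by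
  have hsd : ∀ a ∈ A, ∀ b ∈ A, Disjoint (src a (m a)) (dest b (m b)) := by
    intro a ha b hb
    rw [Set.disjoint_left]
    rintro s ⟨hsa, hs1⟩ ⟨hsb, hs2⟩
    rw [(hA a ha).1.mem_supt] at hsa
    rw [(hA b hb).1.mem_supt] at hsb
    have hne : a ≠ b := by
      rintro rfl
      exact lt_asymm ((hA a ha).lt_apply (h.leftEnd_lt a ha) (h.lt_rightEnd a ha))
        (hs2.trans_lt hs1)
    refine (h.le_apply_of_linked b a ⟨hb, ha, ?_, hsa.1.trans hsb.2, ?_, fun t ht hat => ?_⟩).not_gt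
      (hs2.trans_lt hs1)
    · refine lt_of_le_of_ne (not_lt.1 fun hlt => ?_) fun e => hne (hprop.injOn_leftEnd hA ha hb e.symm)
      exact (h.le_of_leftEnd_lt a ha _ (leftEnd_mem_transitionPoints hA hb) hlt).not_gt
        (hsb.1.trans hs1)
    · refine lt_of_le_of_ne (not_lt.1 fun hlt => ?_)
        fun e => hne (hprop.injOn_rightEnd hA ha hb e.symm)
      exact (h.le_apply_of_lt_rightEnd b hb _ (rightEnd_mem_transitionPoints hA ha) hlt).not_gt
        (hs2.trans_lt hsa.2)
    · by_contra! hlt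
      exact ((h.le_of_leftEnd_lt a ha t ht hat).trans
        (h.le_apply_of_lt_rightEnd b hb t ht hlt)).not_gt (hs2.trans_lt hs1)
  have hss : ∀ a ∈ A, ∀ b ∈ A, leftEnd a < leftEnd b → Disjoint (src a (m a)) (src b (m b)) := by
    intro a ha b hb hlt
    rw [Set.disjoint_left]
    rintro s ⟨-, hs1⟩ ⟨hsb, -⟩
    exact (h.le_of_leftEnd_lt a ha _ (leftEnd_mem_transitionPoints hA hb) hlt).not_gt
      (((hA b hb).1.mem_supt.1 hsb).1.trans hs1)
  have hdd : ∀ a ∈ A, ∀ b ∈ A, rightEnd a < rightEnd b →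
      Disjoint (dest a (m a)) (dest b (m b)) := by
    intro a ha b hb hlt
    rw [Set.disjoint_left]
    rintro s ⟨hsa, -⟩ ⟨-, hs2⟩
    exact (h.le_apply_of_lt_rightEnd b hb _ (rightEnd_mem_transitionPoints hA ha) hlt).not_gt
      (hs2.trans_lt ((hA a ha).1.mem_supt.1 hsa).2)
  refine ⟨hA, m, fun a ha => (hA a ha).1.mem_supt.2 ⟨h.leftEnd_lt a ha, h.lt_rightEnd a ha⟩, ?_⟩
  rintro a ha b hb (_ | _) (_ | _) hne
  · have hab : a ≠ b := fun e => hne (e ▸ rfl)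
    rcases lt_or_gt_of_ne fun e => hab (hprop.injOn_leftEnd hA ha hb e) with hlt | hlt
    · exact hss a ha b hb hlt
    · exact (hss b hb a ha hlt).symm
  · exact hsd a ha b hb
  · exact (hsd b hb a ha).symm
  · have hab : a ≠ b := fun e => hne (e ▸ rfl)
    rcases lt_or_gt_of_ne fun e => hab (hprop.injOn_rightEnd hA ha hb e) with hlt | hlt
    · exact hdd a ha b hb hlt
    · exact (hdd b hb a ha hlt).symm

lemma FastBumps.exists_isAdapted (hfast : FastBumps A) : ∃ m, IsAdapted A m := by
  obtain ⟨hA, m, hm, hd⟩ := hfast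
  have hm' : ∀ a ∈ A, leftEnd a < m a ∧ m a < rightEnd a := fun a ha =>
    (hA a ha).1.mem_supt.1 (hm a ha)
  have hlt : ∀ a ∈ A, m a < a (m a) := fun a ha => (hA a ha).2 _ (hm a ha)
  have hltr : ∀ a ∈ A, a (m a) < rightEnd a := fun a ha =>
    (hA a ha).1.apply_lt_rightEnd (hm' a ha).2
  have hsrc : ∀ a ∈ A, ∀ s, leftEnd a < s → s < m a → s ∈ foot a (m a) false :=
    fun a ha s h1 h2 => ⟨(hA a ha).1.mem_supt.2 ⟨h1, h2.trans (hm' a ha).2⟩, h2⟩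
  have hdest : ∀ a ∈ A, ∀ s, a (m a) < s → s < rightEnd a → s ∈ foot a (m a) true :=
    fun a ha s h1 h2 => ⟨(hA a ha).1.mem_supt.2
      ⟨((hm' a ha).1.trans (hlt a ha)).trans h1, h2⟩, h1.le⟩
  have hss : ∀ a ∈ A, ∀ b ∈ A, a ≠ b → ∀ s, leftEnd a < s → s < m a → leftEnd b < s →
      s < m b → False := fun a ha b hb hne s h1 h2 h3 h4 =>
    Set.disjoint_left.1 (hd a ha b hb false false (by simp [hne]))
      (hsrc a ha s h1 h2) (hsrc b hb s h3 h4)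
  have hsd : ∀ a ∈ A, ∀ b ∈ A, ∀ s, leftEnd a < s → s < m a → b (m b) < s →
      s < rightEnd b → False := fun a ha b hb s h1 h2 h3 h4 =>
    Set.disjoint_left.1 (hd a ha b hb false true (by simp))
      (hsrc a ha s h1 h2) (hdest b hb s h3 h4)
  have hdd : ∀ a ∈ A, ∀ b ∈ A, a ≠ b → ∀ s, a (m a) < s → s < rightEnd a → b (m b) < s →
      s < rightEnd b → False := fun a ha b hb hne s h1 h2 h3 h4 =>
    Set.disjoint_left.1 (hd a ha b hb true true (by simp [hne]))
      (hdest a ha s h1 h2) (hdest b hb s h3 h4)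
  refine ⟨m, fun a ha => (hm' a ha).1, fun a ha => (hm' a ha).2, ?_, ?_, ?_⟩
  · intro a ha t ht hat
    by_contra! htm
    obtain ⟨b, hb, rfl | rfl⟩ := (mem_transitionPoints_iff hA).1 ht
    · obtain ⟨s, h1, h2⟩ := exists_between (lt_min htm (hm' b hb).1)
      exact hss a ha b hb (fun e => hat.ne (e ▸ rfl)) s (hat.trans h1)
        (h2.trans_le (min_le_left _ _)) h1 (h2.trans_le (min_le_right _ _))
    · obtain ⟨s, h1, h2⟩ := exists_between (max_lt hat (hltr b hb))
      exact hsd a ha b hb s ((le_max_left _ _).trans_lt h1) (h2.trans htm)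
        ((le_max_right _ _).trans_lt h1) h2
  · intro a ha t ht hat
    by_contra! htm
    obtain ⟨b, hb, rfl | rfl⟩ := (mem_transitionPoints_iff hA).1 ht
    · obtain ⟨s, h1, h2⟩ := exists_between (lt_min hat (hm' b hb).1)
      exact hsd b hb a ha s h1 (h2.trans_le (min_le_right _ _)) (htm.trans h1)
        (h2.trans_le (min_le_left _ _))
    · obtain ⟨s, h1, h2⟩ := exists_between (max_lt htm (hltr b hb))
      exact hdd a ha b hb (fun e => hat.ne (e ▸ rfl)) s ((le_max_left _ _).trans_lt h1)
        (h2.trans hat) ((le_max_right _ _).trans_lt h1) h2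
  · intro a b hab
    have ha := hab.mem_left
    have hb := hab.mem_right
    by_contra! hlt'
    obtain ⟨s, h1, h2⟩ := exists_between
      (max_lt (lt_min (hm' b hb).1 hab.overlap) (lt_min hlt' (hltr a ha)))
    exact hsd b hb a ha s ((le_max_left _ _).trans_lt h1) (h2.trans_le (min_le_left _ _))
      ((le_max_right _ _).trans_lt h1) (h2.trans_le (min_le_right _ _))

lemma mem_chainTrans_iff {k : ℕ} {c : Fin (k + 1) → Homeo01} {t : UI} :
    t ∈ chainTrans A k c ↔ (∃ i, t ∈ supt (c i)) ∧ t ∈ transitionPoints A :=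
  Iff.rfl

lemma IsAdapted.le_chainApply (hA : ∀ a ∈ A, IsPosBump a) {m : Homeo01 → UI}
    (h : IsAdapted A m) {k : ℕ} {c : Fin (k + 1) → Homeo01} (hmem : ∀ i, c i ∈ A)
    (hlink : ∀ i : Fin k, Linked A (c i.castSucc) (c i.succ)) {u v : UI}
    (hu : u ∈ chainTrans A k c) (hv : v ∈ chainTrans A k c) : v ≤ chainApply k c u := by
  obtain ⟨⟨i, hi⟩, hu⟩ := mem_chainTrans_iff.1 hu
  obtain ⟨⟨j, hj⟩, hv⟩ := mem_chainTrans_iff.1 hv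
  rw [(hA _ (hmem i)).1.mem_supt] at hi
  rw [(hA _ (hmem j)).1.mem_supt] at hj
  have h1 : m (c 0) ≤ u := h.le_of_leftEnd_lt _ (hmem 0) u hu <|
    ((strictMono_leftEnd_of_linked hlink).monotone (Fin.zero_le i)).trans_lt hi.1
  have h2 : v ≤ c (Fin.last k) (m (c (Fin.last k))) :=
    h.le_apply_of_lt_rightEnd _ (hmem _) v hv <|
      hj.2.trans_le ((strictMono_rightEnd_of_linked hlink).monotone (Fin.le_last j))
  exact h2.trans <| PingPong.le_chainApply (fun i => (hA _ (hmem i)).1.1) (s := fun i => m (c i))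
    (fun i => h.le_apply_of_linked _ _ (hlink i)) h1

/-- A marking which is propagated along links, starting from prescribed values `p`. -/
lemma exists_marking (hprop : GeomProper A) (hA : ∀ a ∈ A, IsPosBump a) (hfin : A.Finite)
    (p : Homeo01 → UI) : ∃ m : Homeo01 → UI,
      (∀ a b, Linked A a b → m b = a (m a)) ∧ ∀ b, (∀ a, ¬ Linked A a b) → m b = p b := by
  classical
  let F : (b : Homeo01) → ((a : Homeo01) → Linked A a b → UI) → UI := fun b rec =>
    if h : ∃ a, Linked A a b then h.choose (rec h.choose h.choose_spec) else p b
  refine ⟨(Linked.wellFounded hfin).fix F, fun a b hab => ?_, fun b hb => ?_⟩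
  · have hex : ∃ a, Linked A a b := ⟨a, hab⟩
    rw [(Linked.wellFounded hfin).fix_eq]
    simp only [F, dif_pos hex]
    rw [hex.choose_spec.left_unique hprop hA hab]
  · rw [(Linked.wellFounded hfin).fix_eq]
    exact dif_neg fun ⟨a, ha⟩ => hb a ha

/-- A point in the support of `a` preceding all transition points there, and which is a
transition point unless `a` is isolated. -/
lemma exists_initial_point (hA : ∀ a ∈ A, IsPosBump a) (hfin : A.Finite) {a : Homeo01}
    (ha : a ∈ A) : ∃ p, p ∈ supt a ∧ (∀ t ∈ transitionPoints A, leftEnd a < t → p ≤ t) ∧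
      (¬ IsolatedIn A a → p ∈ transitionPoints A) := by
  have hb := (hA a ha).1
  by_cases hiso : IsolatedIn A a
  · obtain ⟨p, hp⟩ := hb.2.nonempty
    refine ⟨p, hp, fun t ht hat => ?_, fun h => absurd hiso h⟩
    by_contra! htp
    obtain ⟨f, hf, hft⟩ := ht
    exact hiso t (hb.mem_supt.2 ⟨hat, htp.trans (hb.mem_supt.1 hp).2⟩) f hf hft
  · have hne : (transitionPoints A ∩ supt a).Nonempty := by
      simp only [IsolatedIn, not_forall, not_not] at hiso
      obtain ⟨t, ht, f, hf, hft⟩ := hiso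
      exact ⟨t, ⟨f, hf, hft⟩, ht⟩
    obtain ⟨p, hp, hmin⟩ := Set.exists_min_image _ id
      ((transitionPoints_finite hA hfin).inter_of_left _) hne
    refine ⟨p, hp.2, fun t ht hat => ?_, fun _ => hp.1⟩
    by_contra! htp
    exact (hmin t ⟨ht, hb.mem_supt.2 ⟨hat, htp.trans (hb.mem_supt.1 hp.2).2⟩⟩).not_gt htp

lemma exists_isAdapted_of_maxChain (hprop : GeomProper A) (hA : ∀ a ∈ A, IsPosBump a)
    (hfin : A.Finite)
    (H : ∀ (k : ℕ) (c : Fin (k + 1) → Homeo01) (x y : Fin (k + 1) → ℝ),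
      IsSTC A k c x y → MaxChainSet A (range c) → ∀ cmin cmax : UI,
        IsLeast (chainTrans A k c) cmin → IsGreatest (chainTrans A k c) cmax →
        cmax ≤ chainApply k c cmin) : ∃ m, IsAdapted A m := by
  have hp : ∀ a, ∃ p, a ∈ A → p ∈ supt a ∧
      (∀ t ∈ transitionPoints A, leftEnd a < t → p ≤ t) ∧
      (¬ IsolatedIn A a → p ∈ transitionPoints A) := fun a => by
    by_cases ha : a ∈ A
    · obtain ⟨p, hp⟩ := exists_initial_point hA hfin ha
      exact ⟨p, fun _ => hp⟩
    · exact ⟨⊥, fun h => absurd h ha⟩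
  choose p hp using hp
  obtain ⟨m, hmlink, hmroot⟩ := exists_marking hprop hA hfin p
  have hmright : ∀ a ∈ A, m a < rightEnd a := by
    intro a
    induction a using (Linked.wellFounded hfin).induction with
    | _ b ih =>
      intro hb
      by_cases hex : ∃ a, Linked A a b
      · obtain ⟨a, hab⟩ := hex
        rw [hmlink a b hab]
        exact ((hA a hab.mem_left).1.apply_lt_rightEnd (ih a hab hab.mem_left)).trans
          hab.rightEnd_lt
      · rw [hmroot b (not_exists.1 hex)]
        exact ((hA b hb).1.mem_supt.1 (hp b hb).1).2
  have hmle : ∀ a ∈ A, ∀ t ∈ transitionPoints A, leftEnd a < t → m a ≤ t := by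
    intro b hb t ht hbt
    by_cases hex : ∃ a, Linked A a b
    · obtain ⟨a, hab⟩ := hex
      rw [hmlink a b hab]
      exact ((hA a hab.mem_left).1.apply_lt_rightEnd (hmright a hab.mem_left)).le.trans
        (hab.rightEnd_le t ht hbt)
    · rw [hmroot b (not_exists.1 hex)]
      exact (hp b hb).2.1 t ht hbt
  have key : ∀ a ∈ A, leftEnd a < m a ∧
      ∀ t ∈ transitionPoints A, t < rightEnd a → t ≤ a (m a) := by
    intro a ha
    by_cases hiso : IsolatedIn A a
    · have hroot : m a = p a := hmroot a fun b hba => by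
        obtain ⟨f, hf, hft⟩ := rightEnd_mem_transitionPoints hA hba.mem_left
        exact hiso _ ((hA a ha).1.mem_supt.2 ⟨hba.overlap, hba.rightEnd_lt⟩) f hf hft
      have hpa := (hA a ha).1.mem_supt.1 (hp a ha).1
      have hlt := (hA a ha).lt_apply hpa.1 hpa.2
      rw [hroot]
      refine ⟨hpa.1, fun t ht hta => ?_⟩
      by_contra! hlt'
      obtain ⟨f, hf, hft⟩ := ht
      exact hiso t ((hA a ha).1.mem_supt.2 ⟨(hpa.1.trans hlt).trans hlt', hta⟩) f hf hft
    · obtain ⟨S, hS, haS⟩ := exists_maxChainSet hA hfin ha hiso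
      obtain ⟨k, c, x, y, hc, rfl⟩ := hS.1
      obtain ⟨hmem, hlink⟩ := (isSTC_iff hA).1 ⟨x, y, hc⟩
      have hbump : ∀ i, IsBump (c i) := fun i => (hA _ (hmem i).1).1
      have hLmono := (strictMono_leftEnd_of_linked hlink).monotone
      have hp0 := hp (c 0) (hmem 0).1
      have hp0T : p (c 0) ∈ chainTrans A k c := ⟨⟨0, hp0.1⟩, hp0.2.2 (hmem 0).2⟩
      have hmin : IsLeast (chainTrans A k c) (p (c 0)) := by
        refine ⟨hp0T, fun t ht => ?_⟩
        obtain ⟨⟨i, hi⟩, ht⟩ := mem_chainTrans_iff.1 ht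
        exact hp0.2.1 t ht ((hLmono (Fin.zero_le i)).trans_lt ((hbump i).mem_supt.1 hi).1)
      obtain ⟨v, hv, hvmax⟩ := Set.exists_max_image (chainTrans A k c) id
        ((transitionPoints_finite hA hfin).subset fun t ht => ht.2) ⟨_, hp0T⟩
      have hle : v ≤ c (Fin.last k) (m (c (Fin.last k))) :=
        (H k c x y hc hS _ v hmin ⟨hv, hvmax⟩).trans <|
          chainApply_le (fun i => (hbump i).1) (s := fun i => m (c i))
            (fun i => (hmlink _ _ (hlink i)).ge)
            (hmroot _ (hS.not_linked_head hA hmem hlink)).ge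
      have hLv : leftEnd (c (Fin.last k)) < v := by
        have hplast := hp _ (hmem (Fin.last k)).1
        exact ((hbump _).mem_supt.1 hplast.1).1.trans_le
          (hvmax _ ⟨⟨_, hplast.1⟩, hplast.2.2 (hmem _).2⟩)
      have hleft : ∀ i, leftEnd (c i) < m (c i) := by
        intro i
        induction i using Fin.reverseInduction with
        | last =>
          by_contra! hcon
          exact (hLv.trans_le hle).not_ge ((hbump _).apply_le_leftEnd hcon)
        | cast i ih =>
          by_contra! hcon
          rw [hmlink _ _ (hlink i)] at ih
          exact ((hlink i).leftEnd_lt.trans ih).not_ge ((hbump _).apply_le_leftEnd hcon)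
      have hright : ∀ i, ∀ t ∈ transitionPoints A, t < rightEnd (c i) → t ≤ c i (m (c i)) := by
        intro i t ht hti
        induction i using Fin.lastCases with
        | last =>
          refine le_trans ?_ hle
          by_contra! hvt
          exact (hvmax t ⟨⟨_, (hbump _).mem_supt.2 ⟨hLv.trans hvt, hti⟩⟩, ht⟩).not_gt hvt
        | cast i =>
          rw [← hmlink _ _ (hlink i)]
          refine le_trans (not_lt.1 fun hlt => ?_) (hleft i.succ).le
          exact ((hlink i).rightEnd_le t ht hlt).not_gt hti
      obtain ⟨i, rfl⟩ := haS
      exact ⟨hleft i, hright i⟩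
  exact ⟨m, fun a ha => (key a ha).1, hmright, hmle, fun a ha => (key a ha).2,
    fun a b hab => (hmlink a b hab).le⟩

end

/-- **Proposition (FastCriterion).** For a finite geometrically proper set `A` of
positive bump functions, the following are equivalent: (1) `A` is geometrically
fast; (2) every stretched transition chain `C` of `A` satisfies
`C_max ≤ (C_min)(∏C)`; (3) every maximal stretched transition chain of `A`
satisfies the same inequality. -/
theorem fast_criterion (A : Set Homeo01) (hA : ∀ a ∈ A, IsPosBump a)
    (hfin : A.Finite) (hprop : GeomProper A) :
    (FastBumps A ↔
      ∀ (k : ℕ) (c : Fin (k + 1) → Homeo01) (x y : Fin (k + 1) → ℝ),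
        IsSTC A k c x y → ∀ cmin cmax : UI,
          IsLeast (chainTrans A k c) cmin → IsGreatest (chainTrans A k c) cmax →
          cmax ≤ chainApply k c cmin) ∧
    (FastBumps A ↔
      ∀ (k : ℕ) (c : Fin (k + 1) → Homeo01) (x y : Fin (k + 1) → ℝ),
        IsSTC A k c x y → MaxChainSet A (Set.range c) → ∀ cmin cmax : UI,
          IsLeast (chainTrans A k c) cmin → IsGreatest (chainTrans A k c) cmax →
          cmax ≤ chainApply k c cmin) := by
  have h12 : FastBumps A → ∀ (k : ℕ) (c : Fin (k + 1) → Homeo01) (x y : Fin (k + 1) → ℝ),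
      IsSTC A k c x y → ∀ cmin cmax : UI,
        IsLeast (chainTrans A k c) cmin → IsGreatest (chainTrans A k c) cmax →
        cmax ≤ chainApply k c cmin := by
    intro hfast k c x y hc cmin cmax hmin hmax
    obtain ⟨m, hm⟩ := hfast.exists_isAdapted
    obtain ⟨hmem, hlink⟩ := (isSTC_iff hA).1 ⟨x, y, hc⟩
    exact hm.le_chainApply hA (fun i => (hmem i).1) hlink hmin.1 hmax.1
  have h31 := fun H => (exists_isAdapted_of_maxChain hprop hA hfin H).elim
    fun _ hm => hm.fastBumps hprop hA
  exact ⟨⟨h12, fun H => h31 fun k c x y hc _ => H k c x y hc⟩,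
    ⟨fun h k c x y hc _ => h12 h k c x y hc, h31⟩⟩

end PingPong
end

section
/- Let A be a (possibly infinite) geometrically fast set of positive bump functions in Homeo₊(I), equipped with a marking witnessing fastness. If w is a nonempty word and x ∈ J(w), then w is locally reduced at x if and only if w is freely reduced and dest(a) ⊆ supt(b) whenever a,b are consecutive symbols of w. In particular, if w is freely reduced and is locally reduced at some element of J(w), then w is locally reduced at every element of J(w). -/
open Set

namespace PingPong

theorem supt_inv (f : Homeo01) : supt f⁻¹ = supt f := by
  ext t
  exact not_congr (Equiv.Perm.inv_eq_iff_eq.trans eq_comm)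

theorem apply_mem_supt {f : Homeo01} {t : UI} (ht : t ∈ supt f) : f t ∈ supt f :=
  fun h => ht (f.injective h)

theorem IsPosBump.strictMono {a : Homeo01} (ha : IsPosBump a) : StrictMono a :=
  ha.1.1.strictMono_of_injective a.injective

theorem IsPosBump.inv_lt {a : Homeo01} (ha : IsPosBump a) {t : UI} (ht : t ∈ supt a) :
    a⁻¹ t < t := by
  have h : a⁻¹ t ∈ supt a := by
    rw [← supt_inv] at ht ⊢
    exact apply_mem_supt ht
  simpa using ha.2 _ h

theorem IsPosBump.not_isPosBump_inv {a : Homeo01} (ha : IsPosBump a) : ¬ IsPosBump a⁻¹ := by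
  intro h
  obtain ⟨t, ht⟩ := ha.1.2.nonempty
  exact lt_asymm (ha.inv_lt ht) (h.2 t (by rwa [supt_inv]))

theorem IsPosBump.ordConnected_supt {a : Homeo01} (ha : IsPosBump a) : (supt a).OrdConnected :=
  ha.1.2.isPreconnected.ordConnected

theorem IsPosBump.ordConnected_foot {a : Homeo01} (ha : IsPosBump a) (t : UI) (i : Bool) :
    (foot a t i).OrdConnected := by
  cases i
  · exact ha.ordConnected_supt.inter Set.ordConnected_Iio
  · exact ha.ordConnected_supt.inter Set.ordConnected_Ici

theorem foot_subset_supt (a : Homeo01) (t : UI) (i : Bool) : foot a t i ⊆ supt a := by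
  cases i <;> exact fun _ h => h.1

/-- An interval meeting the support of a positive bump but neither of its feet lies between
the feet. -/
theorem IsPosBump.subset_supt_of_disjoint_feet {b : Homeo01} (hb : IsPosBump b) {t y : UI}
    (ht : t ∈ supt b) {D : Set UI} (hD : D.OrdConnected) (hyD : y ∈ D) (hy : y ∈ supt b)
    (hdisj : ∀ i, Disjoint D (foot b t i)) : D ⊆ supt b := by
  have h_inv : b⁻¹ t ∈ supt b := by
    rw [← supt_inv] at ht ⊢
    exact apply_mem_supt ht
  have h_src : b⁻¹ t ∉ D := fun h =>
    Set.disjoint_left.1 (hdisj false) h ⟨h_inv, hb.inv_lt ht⟩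
  have h_dest : b t ∉ D := fun h =>
    Set.disjoint_left.1 (hdisj true) h ⟨apply_mem_supt ht, le_rfl⟩
  have hty : t ≤ y := not_lt.1 fun h => Set.disjoint_left.1 (hdisj false) hyD ⟨hy, h⟩
  have hyt : y < b t := not_le.1 fun h => Set.disjoint_left.1 (hdisj true) hyD ⟨hy, h⟩
  intro z hz
  refine hb.ordConnected_supt.out h_inv (apply_mem_supt ht) ⟨?_, ?_⟩
  · exact not_lt.1 fun h => h_src (hD.out hz hyD ⟨h.le, ((hb.inv_lt ht).trans_le hty).le⟩)
  · exact not_lt.1 fun h => h_dest (hD.out hyD hz ⟨hyt.le, h.le⟩)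

section Symbols

variable {A : Set Homeo01} {m : Homeo01 → UI}

theorem symDest_of_mem {a : Homeo01} (ha : a ∈ A) : symDest A m a = foot a (m a) true := by
  simp [symDest, foot, ha]

theorem symSrc_of_mem {a : Homeo01} (ha : a ∈ A) : symSrc A m a = foot a (m a) false := by
  simp [symSrc, foot, ha]

theorem notMem_of_inv_mem (hA : ∀ a ∈ A, IsPosBump a) {a : Homeo01} (ha : a⁻¹ ∈ A) : a ∉ A :=
  fun h => (hA a h).not_isPosBump_inv (hA _ ha)

theorem symDest_of_inv_mem (hA : ∀ a ∈ A, IsPosBump a) {a : Homeo01} (ha : a⁻¹ ∈ A) :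
    symDest A m a = foot a⁻¹ (m a⁻¹) false := by
  simp [symDest, foot, notMem_of_inv_mem hA ha]

theorem symSrc_of_inv_mem (hA : ∀ a ∈ A, IsPosBump a) {a : Homeo01} (ha : a⁻¹ ∈ A) :
    symSrc A m a = foot a⁻¹ (m a⁻¹) true := by
  simp [symSrc, foot, notMem_of_inv_mem hA ha]

theorem symSrc_eq_symDest_inv (hA : ∀ a ∈ A, IsPosBump a) {a : Homeo01}
    (ha : a ∈ A ∨ a⁻¹ ∈ A) : symSrc A m a = symDest A m a⁻¹ := by
  rcases ha with ha | ha
  · rw [symSrc_of_mem ha, symDest_of_inv_mem hA (by rwa [inv_inv]), inv_inv]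
  · rw [symSrc_of_inv_mem hA ha, symDest_of_mem ha]

theorem symDest_subset_supt (hA : ∀ a ∈ A, IsPosBump a) {a : Homeo01}
    (ha : a ∈ A ∨ a⁻¹ ∈ A) : symDest A m a ⊆ supt a := by
  rcases ha with ha | ha
  · exact symDest_of_mem (m := m) ha ▸ foot_subset_supt _ _ _
  · rw [symDest_of_inv_mem hA ha, ← supt_inv a]
    exact foot_subset_supt _ _ _

theorem ordConnected_symDest (hA : ∀ a ∈ A, IsPosBump a) {a : Homeo01}
    (ha : a ∈ A ∨ a⁻¹ ∈ A) : (symDest A m a).OrdConnected := by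
  rcases ha with ha | ha
  · exact symDest_of_mem (m := m) ha ▸ (hA a ha).ordConnected_foot _ _
  · exact symDest_of_inv_mem (m := m) hA ha ▸ (hA _ ha).ordConnected_foot _ _

theorem apply_mem_symDest (hA : ∀ a ∈ A, IsPosBump a) {a : Homeo01} (ha : a ∈ A ∨ a⁻¹ ∈ A)
    {x : UI} (hx : x ∈ supt a \ symSrc A m a) : a x ∈ symDest A m a := by
  obtain ⟨hxa, hxs⟩ := hx
  rcases ha with ha | ha
  · rw [symSrc_of_mem ha] at hxs
    rw [symDest_of_mem ha]
    exact ⟨apply_mem_supt hxa, (hA a ha).1.1 (not_lt.1 fun h => hxs ⟨hxa, h⟩)⟩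
  · rw [symSrc_of_inv_mem hA ha] at hxs
    rw [symDest_of_inv_mem hA ha]
    have hlt : x < a⁻¹ (m a⁻¹) := not_le.1 fun h => hxs ⟨by rwa [supt_inv], h⟩
    refine ⟨by rw [supt_inv]; exact apply_mem_supt hxa, ?_⟩
    rw [← (hA _ ha).strictMono.lt_iff_lt]
    simpa using hlt

theorem disjoint_symDest (hA : ∀ a ∈ A, IsPosBump a) (hfd : FeetDisjoint A m) {a b : Homeo01}
    (ha : a ∈ A ∨ a⁻¹ ∈ A) (hb : b ∈ A ∨ b⁻¹ ∈ A) (hab : a ≠ b) :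
    Disjoint (symDest A m a) (symDest A m b) := by
  rcases ha with ha | ha <;> rcases hb with hb | hb
  · rw [symDest_of_mem ha, symDest_of_mem hb]
    exact hfd _ ha _ hb _ _ (by simpa using hab)
  · rw [symDest_of_mem ha, symDest_of_inv_mem hA hb]
    exact hfd _ ha _ hb _ _ (by simp)
  · rw [symDest_of_inv_mem hA ha, symDest_of_mem hb]
    exact hfd _ ha _ hb _ _ (by simp)
  · rw [symDest_of_inv_mem hA ha, symDest_of_inv_mem hA hb]
    exact hfd _ ha _ hb _ _ (by simpa using hab)

theorem disjoint_symDest_symSrc (hA : ∀ a ∈ A, IsPosBump a) (hfd : FeetDisjoint A m)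
    {a b : Homeo01} (ha : a ∈ A ∨ a⁻¹ ∈ A) (hb : b ∈ A ∨ b⁻¹ ∈ A) (hba : b ≠ a⁻¹) :
    Disjoint (symDest A m a) (symSrc A m b) := by
  rw [symSrc_eq_symDest_inv hA hb]
  refine disjoint_symDest hA hfd ha (by rwa [inv_inv, or_comm]) ?_
  rintro rfl
  simp at hba

theorem symDest_subset_supt_of_mem (hA : ∀ a ∈ A, IsPosBump a) (hm : IsMarking A m)
    (hfd : FeetDisjoint A m) {a b : Homeo01} (ha : a ∈ A ∨ a⁻¹ ∈ A) (hb : b ∈ A ∨ b⁻¹ ∈ A)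
    (hba : b ≠ a⁻¹) {y : UI} (hya : y ∈ symDest A m a) (hyb : y ∈ supt b) :
    symDest A m a ⊆ supt b := by
  by_cases hab : a = b
  · exact hab ▸ symDest_subset_supt hA ha
  have h_src := disjoint_symDest_symSrc hA hfd ha hb hba
  have h_dest := disjoint_symDest hA hfd ha hb hab
  have hD := ordConnected_symDest (m := m) hA ha
  rcases hb with hb | hb
  · rw [symSrc_of_mem hb] at h_src
    rw [symDest_of_mem hb] at h_dest
    exact (hA b hb).subset_supt_of_disjoint_feet (hm b hb) hD hya hyb
      (Bool.forall_bool.2 ⟨h_src, h_dest⟩)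
  · rw [symSrc_of_inv_mem hA hb] at h_src
    rw [symDest_of_inv_mem hA hb] at h_dest
    rw [← supt_inv] at hyb ⊢
    exact (hA _ hb).subset_supt_of_disjoint_feet (hm _ hb) hD hya hyb
      (Bool.forall_bool.2 ⟨h_dest, h_src⟩)

end Symbols

theorem locallyReducedAt_singleton (a : Homeo01) (x : UI) :
    LocallyReducedAt [a] x ↔ x ∈ supt a := by
  constructor
  · exact fun h => h.2 [] a List.prefix_rfl
  · refine fun h => ⟨List.isChain_singleton a, fun u c hu => ?_⟩
    cases u with
    | nil =>
      obtain ⟨rfl, -⟩ := List.cons_prefix_cons.1 hu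
      exact h
    | cons d u =>
      obtain ⟨-, hu⟩ := List.cons_prefix_cons.1 hu
      simp at hu

theorem locallyReducedAt_cons_cons (a b : Homeo01) (w : List Homeo01) (x : UI) :
    LocallyReducedAt (a :: b :: w) x ↔
      b ≠ a⁻¹ ∧ x ∈ supt a ∧ LocallyReducedAt (b :: w) (a x) := by
  constructor
  · rintro ⟨hfr, h⟩
    obtain ⟨hba, hfr⟩ := List.isChain_cons_cons.1 hfr
    exact ⟨hba, h [] a (by simp), hfr,
      fun u c hu => h (a :: u) c (List.cons_prefix_cons.2 ⟨rfl, hu⟩)⟩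
  · rintro ⟨hba, hx, hfr, h⟩
    refine ⟨List.isChain_cons_cons.2 ⟨hba, hfr⟩, fun u c hu => ?_⟩
    cases u with
    | nil =>
      obtain ⟨rfl, -⟩ := List.cons_prefix_cons.1 hu
      exact hx
    | cons d u =>
      obtain ⟨rfl, hu'⟩ := List.cons_prefix_cons.1 hu
      exact h u c hu'

theorem locallyReducedAt_iff {A : Set Homeo01} {m : Homeo01 → UI} (hA : ∀ a ∈ A, IsPosBump a)
    (hm : IsMarking A m) (hfd : FeetDisjoint A m) (w : List Homeo01) (hw : WordOn A w)
    (x : UI) (hx : x ∈ Jset A m w) :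
    LocallyReducedAt w x ↔
      FreelyReduced w ∧ List.IsChain (fun a b => symDest A m a ⊆ supt b) w := by
  induction w generalizing x with
  | nil => exact hx.elim
  | cons a w ih =>
    cases w with
    | nil =>
      rw [locallyReducedAt_singleton]
      exact ⟨fun _ => ⟨List.isChain_singleton a, List.isChain_singleton a⟩, fun _ => hx.1⟩
    | cons b w =>
      have ha : a ∈ A ∨ a⁻¹ ∈ A := hw a (by simp)
      have hb : b ∈ A ∨ b⁻¹ ∈ A := hw b (by simp)
      have hy : a x ∈ symDest A m a := apply_mem_symDest hA ha hx
      have hJ (hba : b ≠ a⁻¹) (hyb : a x ∈ supt b) : a x ∈ Jset A m (b :: w) :=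
        ⟨hyb, Set.disjoint_left.1 (disjoint_symDest_symSrc hA hfd ha hb hba) hy⟩
      specialize ih (fun c hc => hw c (List.mem_cons_of_mem a hc)) (a x)
      rw [locallyReducedAt_cons_cons, List.isChain_cons_cons]
      constructor
      · rintro ⟨hba, -, hred⟩
        have hyb : a x ∈ supt b := hred.2 [] b (by simp)
        obtain ⟨hfr, hchain⟩ := (ih (hJ hba hyb)).1 hred
        exact ⟨List.isChain_cons_cons.2 ⟨hba, hfr⟩,
          symDest_subset_supt_of_mem hA hm hfd ha hb hba hy hyb, hchain⟩
      · rintro ⟨hfr, hsub, hchain⟩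
        obtain ⟨hba, hfr⟩ := List.isChain_cons_cons.1 hfr
        exact ⟨hba, hx.1, (ih (hJ hba (hsub hy))).2 ⟨hfr, hchain⟩⟩

/-- **Lemma (threaded).** For a geometrically fast marked set `A` of positive bumps
and a nonempty `A`-word `w`: for `x ∈ J(w)`, `w` is locally reduced at `x` iff `w`
is freely reduced and `dest(a) ⊆ supt(b)` for all consecutive symbols `a, b` of `w`;
in particular a freely reduced word locally reduced at some point of `J(w)` is
locally reduced at every point of `J(w)`. -/
theorem threaded (A : Set Homeo01) (m : Homeo01 → UI)
    (hA : ∀ a ∈ A, IsPosBump a) (hm : IsMarking A m) (hfd : FeetDisjoint A m)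
    (w : List Homeo01) (hw : WordOn A w) (hne : w ≠ []) :
    (∀ x ∈ Jset A m w,
      (LocallyReducedAt w x ↔
        FreelyReduced w ∧ List.Chain' (fun a b => symDest A m a ⊆ supt b) w)) ∧
    (FreelyReduced w → (∃ y ∈ Jset A m w, LocallyReducedAt w y) →
      ∀ y ∈ Jset A m w, LocallyReducedAt w y) := by
  have key := locallyReducedAt_iff hA hm hfd w hw
  exact ⟨key, fun _ ⟨y, hy, hred⟩ z hz => (key z hz).2 ((key y hy).1 hred)⟩

end PingPong
end
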